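/- Let P and Q be countable PO systems, α : Q → P a surjective morphism of PO systems, and 𝒴 a trim Q-partition of the ω-Stone space W. Then there exists a unique trim P-partition 𝒵 of W (denoted 𝒴α) such that 𝒴 regularly refines 𝒵 via α. -/

import Mathlib

open Set Filter Topology

universe u v

/-- A PO system: a set with a transitive antisymmetric relation `<`. -/
structure POSystem (P : Type u) : Type u where
  lt : P → P → Prop
  lt_trans : ∀ {a b c}, lt a b → lt b c → lt a c
  lt_antisymm : ∀ {a b}, lt a b → lt b a → a = b

namespace POSystem

variable {P : Type*} {Q : Type*}

/-- `a ≤ b` iff `a < b` or `a = b`. -/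
def le (S : POSystem P) (a b : P) : Prop := S.lt a b ∨ a = b

theorem le_trans {S : POSystem P} {a b c : P} (h1 : S.le a b) (h2 : S.le b c) :
    S.le a c := by
  rcases h1 with h1 | rfl
  · rcases h2 with h2 | rfl
    · exact Or.inl (S.lt_trans h1 h2)
    · exact Or.inl h1
  · exact h2

/-- A morphism of PO systems. -/
def IsMorphism (SQ : POSystem Q) (SP : POSystem P) (α : Q → P) : Prop :=
  ∀ q : Q, α '' {r | SQ.lt q r} = {p | SP.lt (α q) p}

/-- An isomorphism of PO systems. -/
def IsIso (SQ : POSystem Q) (SP : POSystem P) (β : Q → P) : Prop :=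
  Function.Bijective β ∧ ∀ a b : Q, SQ.lt a b ↔ SP.lt (β a) (β b)

/-- An ideal of a PO system: a nonempty directed lower subset. -/
def IsIdeal (S : POSystem P) (J : Set P) : Prop :=
  J.Nonempty ∧ (∀ x ∈ J, ∀ y : P, S.le y x → y ∈ J) ∧
    ∀ x ∈ J, ∀ y ∈ J, ∃ z ∈ J, S.le x z ∧ S.le y z

/-- An ideal of a subset `Qs` of a PO system. -/
def IsIdealOf (S : POSystem P) (Qs : Set P) (J : Set P) : Prop :=
  J.Nonempty ∧ J ⊆ Qs ∧ (∀ x ∈ J, ∀ y ∈ Qs, S.le y x → y ∈ J) ∧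
    ∀ x ∈ J, ∀ y ∈ J, ∃ z ∈ J, S.le x z ∧ S.le y z

/-- The principal ideal `p↓`. -/
def principalIdeal (S : POSystem P) (p : P) : Set P := {q | S.le q p}

theorem principal_isIdeal (S : POSystem P) (p : P) : IsIdeal S (principalIdeal S p) :=
  ⟨⟨p, Or.inr rfl⟩, fun _ hx y hy => le_trans hy hx,
    fun _ hx _ hy => ⟨p, Or.inr rfl, hx, hy⟩⟩

/-- `p` is the supremum of the subset `A`. -/
def IsSupOf (S : POSystem P) (p : P) (A : Set P) : Prop :=
  (∀ a ∈ A, S.le a p) ∧ ∀ q : P, (∀ a ∈ A, S.le a q) → S.le p q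

/-- `p` is separated in `P` if it is not the supremum of a strictly increasing sequence. -/
def Separated (S : POSystem P) (p : P) : Prop :=
  ¬ ∃ u : ℕ → P, (∀ n, S.lt (u n) (u (n + 1)) ∧ u n ≠ u (n + 1)) ∧
      IsSupOf S p (Set.range u)

/-- `p` is compact in `P`. -/
def CompactIn (S : POSystem P) (p : P) : Prop :=
  ∀ J : Set P, IsIdeal S J → ∀ s : P, IsSupOf S s J → S.le p s → p ∈ J

/-- The lower closure `N↓` of a subset. -/
def downSet (S : POSystem P) (N : Set P) : Set P := {p | ∃ q ∈ N, S.le p q}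

/-- `N` has a finite foundation. -/
def HasFinFoundation (S : POSystem P) (N : Set P) : Prop :=
  ∃ F : Set P, F.Finite ∧ F ⊆ downSet S N ∧ ∀ r ∈ downSet S N, ∃ p ∈ F, S.le p r

def PDelta (S : POSystem P) : Set P := {p | HasFinFoundation S {p}}

def IsLowerSubset (S : POSystem P) (L : Set P) : Prop :=
  ∀ p ∈ L, ∀ q : P, S.le q p → q ∈ L

/-- Minimal elements of `L`. -/
def minIn (S : POSystem P) (L : Set P) : Set P :=
  {p | p ∈ L ∧ ∀ q ∈ L, S.le q p → q = p}

/-- `L_min^d`: minimal elements of `L` lying in `P^d`. -/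
def LminD (S : POSystem P) (L : Set P) : Set P := {p | p ∈ minIn S L ∧ ¬ S.lt p p}

/-- `(P, L, f)` is an extended PO system. -/
def IsExtPO (S : POSystem P) (L : Set P) (f : P → ℕ) : Prop :=
  IsLowerSubset S L ∧ L ⊆ PDelta S ∧ ∀ p ∈ LminD S L, 0 < f p

/-- The order relation on the ideal completion `id(P)`: ordered by inclusion, with
`id(P)^d` the principal ideals `p↓` for `p ∈ P^d`. -/
def idLt (S : POSystem P) (J K : {J : Set P // IsIdeal S J}) : Prop :=
  (J.1 ⊆ K.1 ∧ J ≠ K) ∨ (J = K ∧ ¬ ∃ p : P, ¬ S.lt p p ∧ J.1 = principalIdeal S p)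

/-- The ideal completion `id(P)` of a PO system. -/
def idPO (S : POSystem P) : POSystem {J : Set P // IsIdeal S J} where
  lt := idLt S
  lt_trans := by
    intro a b c h1 h2
    unfold idLt at h1 h2 ⊢
    rcases h1 with ⟨hab, hne⟩ | ⟨heq, h⟩
    · rcases h2 with ⟨hbc, hne'⟩ | ⟨heq', h'⟩
      · refine Or.inl ⟨hab.trans hbc, fun hac => hne ?_⟩
        exact Subtype.ext (subset_antisymm hab (by rw [hac]; exact hbc))
      · rw [← heq']; exact Or.inl ⟨hab, hne⟩
    · rw [heq]; exact h2
  lt_antisymm := by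
    intro a b h1 h2
    unfold idLt at h1 h2
    rcases h1 with ⟨hab, _⟩ | ⟨heq, _⟩
    · rcases h2 with ⟨hba, _⟩ | ⟨heq, _⟩
      · exact Subtype.ext (subset_antisymm hab hba)
      · exact heq.symm
    · exact heq

/-- The restriction of a PO system to a subset. -/
def restrictPO (S : POSystem P) (T : Set P) : POSystem T where
  lt a b := S.lt a b
  lt_trans := fun h1 h2 => S.lt_trans h1 h2
  lt_antisymm := fun h1 h2 => Subtype.ext (S.lt_antisymm h1 h2)

end POSystem

open POSystem

section Partitions

variable {W : Type*} [TopologicalSpace W] {P : Type*} {Q : Type*}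

/-- The derived set (set of limit points) of `A`. -/
def limitPts (A : Set W) : Set W := {x | x ∈ closure (A \ {x})}

/-- The type `T(A)` of a subset `A` with respect to a partition `X`. -/
def ptype (X : P → Set W) (A : Set W) : Set P := {p | (A ∩ X p).Nonempty}

/-- A `P`-partition of `W`: pairwise disjoint nonempty sets `X p` such that
`(X p)' ∩ X = ⋃_{q < p} X q`. -/
def IsPPartition (S : POSystem P) (X : P → Set W) : Prop :=
  (∀ p, (X p).Nonempty) ∧ (Pairwise fun p q => Disjoint (X p) (X q)) ∧
    ∀ p, limitPts (X p) ∩ (⋃ q, X q) = ⋃ q ∈ {q : P | S.lt q p}, X q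

/-- `A` is a `p`-trim set. -/
def IsTrimAt (S : POSystem P) (X : P → Set W) (A : Set W) (p : P) : Prop :=
  IsCompact A ∧ IsOpen A ∧ ptype X A = {q | S.le p q} ∧
    (¬ S.lt p p → ∃! x, x ∈ A ∩ X p)

/-- `A` is a trim set. -/
def IsTrimSet (S : POSystem P) (X : P → Set W) (A : Set W) : Prop :=
  ∃ p, IsTrimAt S X A p

/-- `P̂`: the set of `p` for which some `p`-trim set exists. -/
def Phat (S : POSystem P) (X : P → Set W) : Set P := {p | ∃ A, IsTrimAt S X A p}

/-- Axiom T1: every point has a neighbourhood base of trim sets. -/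
def HasTrimBases (S : POSystem P) (X : P → Set W) : Prop :=
  ∀ w : W, ∀ U ∈ nhds w, ∃ A, IsTrimSet S X A ∧ w ∈ A ∧ A ⊆ U

/-- Axiom T2 (fullness). -/
def IsFull (S : POSystem P) (X : P → Set W) : Prop :=
  ∀ p ∈ Phat S X, ∀ w : W,
    (∀ U ∈ nhds w, ∃ A, IsTrimAt S X A p ∧ w ∈ A ∧ A ⊆ U) → w ∈ X p

/-- `w` is a clean point. -/
def IsCleanPt (S : POSystem P) (X : P → Set W) (w : W) : Prop :=
  ∃ p, w ∈ X p ∧ ∃ A, IsTrimAt S X A p ∧ w ∈ A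

/-- Axiom T3: all points of `X` are clean. -/
def AllClean (S : POSystem P) (X : P → Set W) : Prop :=
  ∀ p : P, ∀ w ∈ X p, ∃ A, IsTrimAt S X A p ∧ w ∈ A

/-- A trim `P`-partition. -/
def IsTrimPartition (S : POSystem P) (X : P → Set W) : Prop :=
  IsPPartition S X ∧ HasTrimBases S X ∧ IsFull S X ∧ AllClean S X

/-- A complete partition: the blocks cover `W`. -/
def IsCompletePartition (X : P → Set W) : Prop := (⋃ p, X p) = Set.univ

/-- `Y` refines `Z` via `α`. -/
def Refines (Y : Q → Set W) (Z : P → Set W) (α : Q → P) : Prop :=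
  ∀ q, Y q ⊆ Z (α q)

/-- `Y` regularly refines `Z` via `α` (`Z` regularly consolidates `Y` via `α`). -/
def RegRefines (SQ : POSystem Q) (SP : POSystem P) (Y : Q → Set W) (Z : P → Set W)
    (α : Q → P) : Prop :=
  Refines Y Z α ∧ ∀ p ∈ Phat SP Z, ∀ A : Set W, IsTrimAt SP Z A p → p ∈ α '' ptype Y A

/-- A semi-trim partition: T1, T2, and clean points are dense in each `X p`, `p ∈ P̂`. -/
def IsSemiTrim (S : POSystem P) (X : P → Set W) : Prop :=
  IsPPartition S X ∧ HasTrimBases S X ∧ IsFull S X ∧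
    ∀ p ∈ Phat S X, X p ⊆ closure {w | w ∈ X p ∧ ∃ A, IsTrimAt S X A p ∧ w ∈ A}

/-- A strongly semi-trim partition: T1, T2, and all points of `X p` are clean, `p ∈ P̂`. -/
def IsStronglySemiTrim (S : POSystem P) (X : P → Set W) : Prop :=
  IsPPartition S X ∧ HasTrimBases S X ∧ IsFull S X ∧
    ∀ p ∈ Phat S X, ∀ w ∈ X p, ∃ A, IsTrimAt S X A p ∧ w ∈ A

/-- The labels of a sequence are pairwise strictly incomparable or strictly increasing. -/
def PairwiseIncompOrStrictIncr (S : POSystem P) (τ : ℕ → P) : Prop :=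
  (∀ j k, j ≠ k → ¬ S.le (τ j) (τ k)) ∨ (∀ j k, j < k → S.lt (τ j) (τ k) ∧ τ j ≠ τ k)

/-- A rank `P`-partition: a complete `P`-partition satisfying RP1 and RP2. -/
def IsRankPartition (S : POSystem P) (X : P → Set W) : Prop :=
  IsPPartition S X ∧ IsCompletePartition X ∧
    (∀ q : P, Separated S q → ∀ (x : W) (u : ℕ → W) (τx : P) (τu : ℕ → P),
      x ∈ X τx → (∀ k, u k ∈ X (τu k)) →
      Filter.Tendsto u Filter.atTop (nhds x) → (∀ k, u k ≠ x) →
      S.le q τx → PairwiseIncompOrStrictIncr S τu →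
      ∀ᶠ k in Filter.atTop, S.le q (τu k)) ∧
    (∀ (x : W) (τx : P), x ∈ X τx → ¬ Separated S τx →
      ∃ u : ℕ → W, Filter.Tendsto u Filter.atTop (nhds x) ∧
        ∀ k, ∃ q, u k ∈ X q ∧ S.lt q τx ∧ q ≠ τx)

/-- `I_w`: the set of types of trim neighbourhoods of `w`. -/
def Iw (S : POSystem P) (X : P → Set W) (w : W) : Set P :=
  {p | ∃ A : Set W, IsTrimAt S X A p ∧ w ∈ A}

/-- A trim `(P, L, f)`-partition. -/
def IsTrimPLF (S : POSystem P) (L : Set P) (f : P → ℕ) (Z : P → Set W) : Prop :=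
  IsTrimPartition S Z ∧ (∀ p, IsCompact (closure (Z p)) ↔ p ∈ L) ∧
    ∀ p ∈ LminD S L, Nat.card (Z p) = f p

/-- A bounded trim `(P, L, f)`-partition. -/
def IsBoundedTrimPLF (S : POSystem P) (L : Set P) (f : P → ℕ) (Z : P → Set W) : Prop :=
  IsTrimPLF S L f Z ∧ IsCompact (closure (⋃ p ∈ L, Z p))

end Partitions

section Primitive

variable {W : Type*} [TopologicalSpace W]

/-- The ideal `(A)` of compact open subsets of `A`. -/
def coIdeal (A : Set W) : Set (Set W) := {C | IsCompact C ∧ IsOpen C ∧ C ⊆ A}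

/-- `(A) ≅ (B)` as Boolean rings (equivalently, as posets). -/
def IdealIso (A B : Set W) : Prop := Nonempty (↥(coIdeal A) ≃o ↥(coIdeal B))

/-- `(A) × (B) ≅ (A)`. -/
def ProdIdealIso (A B : Set W) : Prop :=
  Nonempty ((↥(coIdeal A) × ↥(coIdeal B)) ≃o ↥(coIdeal A))

/-- A compact open `A` is pseudo-indecomposable (PI). -/
def IsPISet (A : Set W) : Prop :=
  IsCompact A ∧ IsOpen A ∧ ∀ B : Set W, IsCompact B → IsOpen B → B ⊆ A →
    IdealIso B A ∨ IdealIso (A \ B) A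

/-- `W` is primitive: every compact open set is a finite disjoint union of PI sets. -/
def PrimitiveSpace (W : Type*) [TopologicalSpace W] : Prop :=
  ∀ A : Set W, IsCompact A → IsOpen A →
    ∃ (n : ℕ) (F : Fin n → Set W), (∀ i, IsPISet (F i)) ∧
      (Pairwise fun i j => Disjoint (F i) (F j)) ∧ A = ⋃ i, F i

/-- The setoid of PI compact opens up to isomorphism of their ideals. -/
def piIsoSetoid (W : Type*) [TopologicalSpace W] : Setoid {A : Set W // IsPISet A} where
  r A B := IdealIso A.1 B.1
  iseqv := ⟨fun _ => ⟨OrderIso.refl _⟩,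
    fun h => h.elim fun e => ⟨e.symm⟩,
    fun h1 h2 => h1.elim fun e => h2.elim fun f => ⟨e.trans f⟩⟩

/-- The underlying set of the structure diagram `𝒮(W)`: isomorphism classes of
PI compact open subsets of `W`. -/
def SDiagram (W : Type*) [TopologicalSpace W] : Type _ := Quotient (piIsoSetoid W)

/-- The relation on `𝒮(W)`: `[A] < [B]` iff `(A) × (B) ≅ (A)`. -/
def SDiagramLt {W : Type*} [TopologicalSpace W] (x y : SDiagram W) : Prop :=
  ∃ A B : {A : Set W // IsPISet A}, x = Quotient.mk (piIsoSetoid W) A ∧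
    y = Quotient.mk (piIsoSetoid W) B ∧ ProdIdealIso A.1 B.1

/-- The blocks of the canonical partition `𝒳(W)`: points having a neighbourhood base
of compact open sets of class `p`. -/
def canonicalBlock {W : Type*} [TopologicalSpace W] (p : SDiagram W) : Set W :=
  {w | ∀ U ∈ nhds w, ∃ A : {A : Set W // IsPISet A},
      Quotient.mk (piIsoSetoid W) A = p ∧ w ∈ A.1 ∧ A.1 ⊆ U}

/-- The setoid of points of `W` under the homeomorphism group. -/
def homeoSetoid (W : Type*) [TopologicalSpace W] : Setoid W where
  r w x := ∃ h : W ≃ₜ W, h w = x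
  iseqv := ⟨fun w => ⟨Homeomorph.refl W, rfl⟩,
    fun h => h.elim fun e he => ⟨e.symm, by rw [← he, Homeomorph.symm_apply_apply]⟩,
    fun h1 h2 => h1.elim fun e he => h2.elim fun f hf =>
      ⟨e.trans f, by rw [Homeomorph.trans_apply, he, hf]⟩⟩

end Primitive

section Aux

variable {W : Type*} [TopologicalSpace W] {P : Type*} {Q : Type*}

theorem aux_le_antisymm (S : POSystem P) {a b : P} (h1 : S.le a b) (h2 : S.le b a) : a = b := by
  rcases h1 with h1 | h1
  · rcases h2 with h2 | h2
    · exact S.lt_antisymm h1 h2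
    · exact h2.symm
  · exact h1

theorem aux_ptype_mono {X : P → Set W} {A B : Set W} (h : A ⊆ B) : ptype X A ⊆ ptype X B :=
  fun _ ⟨x, hx⟩ => ⟨x, h hx.1, hx.2⟩

theorem aux_trim_mem {S : POSystem P} {X : P → Set W} {A : Set W} {p q : P}
    (h : IsTrimAt S X A p) : q ∈ ptype X A ↔ S.le p q := by
  rw [h.2.2.1]; rfl

theorem aux_trim_le {S : POSystem P} {X : P → Set W} {A B : Set W} {p q : P}
    (hA : IsTrimAt S X A p) (hB : IsTrimAt S X B q) (h : A ⊆ B) : S.le q p :=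
  (aux_trim_mem hB).1 (aux_ptype_mono h ((aux_trim_mem hA).2 (Or.inr rfl)))

theorem aux_trim_nhds {S : POSystem P} {X : P → Set W} {A : Set W} {p : P} {w : W}
    (hA : IsTrimAt S X A p) (hw : w ∈ A) : A ∈ nhds w := hA.2.1.mem_nhds hw

theorem aux_base {S : POSystem P} {X : P → Set W} (hX : IsTrimPartition S X) {p : P} {w : W}
    (hw : w ∈ X p) {U : Set W} (hU : U ∈ nhds w) : ∃ A, IsTrimAt S X A p ∧ w ∈ A ∧ A ⊆ U := by
  obtain ⟨B, hB, hwB⟩ := hX.2.2.2 p w hw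
  obtain ⟨A, ⟨r, hA⟩, hwA, hAU⟩ := hX.2.1 w (U ∩ B) (inter_mem hU (aux_trim_nhds hB hwB))
  have h1 := aux_trim_le hA hB (hAU.trans inter_subset_right)
  have h2 : S.le r p := (aux_trim_mem hA).1 ⟨w, hwA, hw⟩
  have := aux_le_antisymm S h1 h2
  subst this
  exact ⟨A, hA, hwA, hAU.trans inter_subset_left⟩

/-- The type of an open set is the image of its finer type. -/
theorem aux_ptype_eq {SP : POSystem P} {SQ : POSystem Q} {α : Q → P} {Y : Q → Set W}
    {Z : P → Set W} (hZ : IsTrimPartition SP Z) (hR : RegRefines SQ SP Y Z α)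
    {A : Set W} (hA : IsOpen A) : ptype Z A = α '' ptype Y A := by
  apply Subset.antisymm
  · rintro p ⟨x, hxA, hxp⟩
    obtain ⟨C, hC, _, hCA⟩ := aux_base hZ hxp (hA.mem_nhds hxA)
    exact image_mono (aux_ptype_mono hCA) (hR.2 p ⟨C, hC⟩ C hC)
  · rintro _ ⟨q, ⟨x, hxA, hxq⟩, rfl⟩
    exact ⟨x, hxA, hR.1 q hxq⟩

theorem aux_unique {SP : POSystem P} {SQ : POSystem Q} {α : Q → P} {Y : Q → Set W}
    {Z1 Z2 : P → Set W} (h1 : IsTrimPartition SP Z1) (hR1 : RegRefines SQ SP Y Z1 α)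
    (h2 : IsTrimPartition SP Z2) (hR2 : RegRefines SQ SP Y Z2 α) (p : P) : Z1 p ⊆ Z2 p := by
  intro w hw
  obtain ⟨B, hB, hwB⟩ := h1.2.2.2 p w hw
  have key : ∀ U ∈ nhds w, ∃ A, IsTrimAt SP Z2 A p ∧ w ∈ A ∧ A ⊆ U := by
    intro U hU
    obtain ⟨C, ⟨r, hC⟩, hwC, hCU⟩ := h2.2.1 w (U ∩ B) (inter_mem hU (aux_trim_nhds hB hwB))
    have e : ptype Z1 C = ptype Z2 C := by
      rw [aux_ptype_eq h1 hR1 hC.2.1, aux_ptype_eq h2 hR2 hC.2.1]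
    have hrp : SP.le r p := (aux_trim_mem hC).1 (e ▸ ⟨w, hwC, hw⟩)
    have hr : r ∈ ptype Z1 C := by rw [e]; exact (aux_trim_mem hC).2 (Or.inr rfl)
    have hpr : SP.le p r :=
      (aux_trim_mem hB).1 (aux_ptype_mono (hCU.trans inter_subset_right) hr)
    have := aux_le_antisymm SP hpr hrp
    subst this
    exact ⟨C, hC, hwC, hCU.trans inter_subset_left⟩
  obtain ⟨A, hA, _⟩ := key univ univ_mem
  exact h2.2.2.1 p ⟨A, hA⟩ w key

/-- The consolidation. -/
def consol (SQ : POSystem Q) (Y : Q → Set W) (α : Q → P) (p : P) : Set W :=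
  {w | ∃ U ∈ nhds w, ∀ A q, IsTrimAt SQ Y A q → w ∈ A → A ⊆ U → α q = p}

variable {SP : POSystem P} {SQ : POSystem Q} {α : Q → P} {Y : Q → Set W}

theorem aux_mor_lt (hmor : POSystem.IsMorphism SQ SP α) {q r : Q} (h : SQ.lt q r) :
    SP.lt (α q) (α r) := by
  have : α r ∈ α '' {r | SQ.lt q r} := ⟨r, h, rfl⟩
  rw [hmor q] at this; exact this

theorem aux_mor_lift (hmor : POSystem.IsMorphism SQ SP α) {q : Q} {p : P} (h : SP.lt (α q) p) :
    ∃ r, SQ.lt q r ∧ α r = p := by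
  have : p ∈ {p | SP.lt (α q) p} := h
  rw [← hmor q] at this; exact this

theorem consol_base (hY : IsTrimPartition SQ Y) {p : P} {w : W} (hw : w ∈ consol SQ Y α p)
    {U : Set W} (hU : U ∈ nhds w) :
    ∃ A q, IsTrimAt SQ Y A q ∧ w ∈ A ∧ A ⊆ U ∧ α q = p := by
  obtain ⟨V, hV, h⟩ := hw
  obtain ⟨A, ⟨q, hA⟩, hwA, hAU⟩ := hY.2.1 w (U ∩ V) (inter_mem hU hV)
  exact ⟨A, q, hA, hwA, hAU.trans inter_subset_left, h A q hA hwA (hAU.trans inter_subset_right)⟩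

theorem consol_refines (q : Q) (hY : IsTrimPartition SQ Y) : Y q ⊆ consol SQ Y α (α q) := by
  intro w hw
  obtain ⟨B, hB, hwB⟩ := hY.2.2.2 q w hw
  refine ⟨B, aux_trim_nhds hB hwB, fun A r hA hwA hAB => ?_⟩
  rw [aux_le_antisymm SQ (aux_trim_le hA hB hAB) ((aux_trim_mem hA).1 ⟨w, hwA, hw⟩)]

theorem consol_ptype (hY : IsTrimPartition SQ Y) {A : Set W} (hA : IsOpen A) :
    ptype (consol SQ Y α) A = α '' ptype Y A := by
  apply Subset.antisymm
  · rintro p ⟨x, hxA, hxp⟩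
    obtain ⟨C, q, hC, _, hCA, rfl⟩ := consol_base hY hxp (hA.mem_nhds hxA)
    exact ⟨q, aux_ptype_mono hCA ((aux_trim_mem hC).2 (Or.inr rfl)), rfl⟩
  · rintro _ ⟨q, ⟨x, hxA, hxq⟩, rfl⟩
    exact ⟨x, hxA, consol_refines q hY hxq⟩

theorem consol_discrete (hmor : POSystem.IsMorphism SQ SP α) (hY : IsTrimPartition SQ Y) {p : P}
    (hp : ¬ SP.lt p p) {w : W} (hw : w ∈ consol SQ Y α p) : ∃ q, α q = p ∧ w ∈ Y q := by
  have hw0 := hw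
  obtain ⟨U, hU, h⟩ := hw
  obtain ⟨B, q, hB, hwB, hBU, rfl⟩ := consol_base hY hw0 hU
  refine ⟨q, rfl, hY.2.2.1 q ⟨B, hB⟩ w fun V hV => ?_⟩
  obtain ⟨A, ⟨r, hA⟩, hwA, hAV⟩ := hY.2.1 w (V ∩ B) (inter_mem hV (aux_trim_nhds hB hwB))
  have hAB := hAV.trans inter_subset_right
  rcases aux_trim_le hA hB hAB with hlt | rfl
  · have h1 := aux_mor_lt hmor hlt
    rw [h A r hA hwA (hAB.trans hBU)] at h1
    exact absurd h1 hp
  · exact ⟨A, hA, hwA, hAV.trans inter_subset_left⟩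

theorem consol_trim (hmor : POSystem.IsMorphism SQ SP α) (hY : IsTrimPartition SQ Y)
    {A : Set W} {q : Q} (hA : IsTrimAt SQ Y A q) :
    IsTrimAt SP (consol SQ Y α) A (α q) := by
  refine ⟨hA.1, hA.2.1, ?_, fun hd => ?_⟩
  · rw [consol_ptype hY hA.2.1, hA.2.2.1]
    ext p
    constructor
    · rintro ⟨r, hr | rfl, rfl⟩
      · exact Or.inl (aux_mor_lt hmor hr)
      · exact Or.inr rfl
    · rintro (h | rfl)
      · obtain ⟨r, hr, rfl⟩ := aux_mor_lift hmor h
        exact ⟨r, Or.inl hr, rfl⟩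
      · exact ⟨q, Or.inr rfl, rfl⟩
  · obtain ⟨x, hx, hu⟩ := hA.2.2.2 (fun h => hd (aux_mor_lt hmor h))
    refine ⟨x, ⟨hx.1, consol_refines q hY hx.2⟩, fun y hy => hu y ⟨hy.1, ?_⟩⟩
    obtain ⟨r, hr, hyr⟩ := consol_discrete hmor hY hd hy.2
    rcases (aux_trim_mem hA).1 ⟨y, hy.1, hyr⟩ with hlt | rfl
    · have := aux_mor_lt hmor hlt
      rw [hr] at this
      exact absurd this hd
    · exact hyr

theorem consol_unique_index (hY : IsTrimPartition SQ Y) {p r : P} {w : W}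
    (hp : w ∈ consol SQ Y α p) (hr : w ∈ consol SQ Y α r) : p = r := by
  obtain ⟨U, hU, h⟩ := hp
  obtain ⟨A, q, hA, hwA, hAU, rfl⟩ := consol_base hY hr hU
  exact (h A q hA hwA hAU).symm

theorem consol_isPPartition (hsurj : Function.Surjective α) (hmor : POSystem.IsMorphism SQ SP α)
    (hY : IsTrimPartition SQ Y) : IsPPartition SP (consol SQ Y α) := by
  refine ⟨fun p => ?_, fun p r hpr => ?_, fun p => ?_⟩
  · obtain ⟨q, rfl⟩ := hsurj p
    exact (hY.1.1 q).mono (consol_refines q hY)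
  · exact Set.disjoint_left.2 fun w h1 h2 => hpr (consol_unique_index hY h1 h2)
  · ext w
    simp only [mem_inter_iff, mem_iUnion, mem_setOf_eq, exists_prop]
    constructor
    · rintro ⟨hl, r, hr⟩
      refine ⟨r, ?_, hr⟩
      obtain ⟨A, q, hA, hwA, -, rfl⟩ := consol_base hY hr univ_mem
      have hA' := consol_trim (SP := SP) hmor hY hA
      obtain ⟨y, hyA, hy, hyw⟩ := mem_closure_iff.1 hl A hA.2.1 hwA
      rcases (aux_trim_mem hA').1 ⟨y, hyA, hy⟩ with hlt | rfl
      · exact hlt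
      · by_contra hd
        obtain ⟨x, _, hu⟩ := hA'.2.2.2 hd
        exact hyw ((hu y ⟨hyA, hy⟩).trans (hu w ⟨hwA, hr⟩).symm)
    · rintro ⟨r, hlt, hr⟩
      refine ⟨?_, r, hr⟩
      refine mem_closure_iff.2 fun U hU hwU => ?_
      obtain ⟨A, q, hA, hwA, hAU, rfl⟩ := consol_base hY hr (hU.mem_nhds hwU)
      have hA' := consol_trim (SP := SP) hmor hY hA
      by_cases hwY : ∃ s, w ∈ Y s
      · obtain ⟨s, hs⟩ := hwY
        have e := consol_unique_index hY hr (consol_refines s hY hs)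
        rw [e] at hlt
        obtain ⟨t, hst, rfl⟩ := aux_mor_lift hmor hlt
        have : w ∈ limitPts (Y t) ∩ ⋃ q, Y q := by
          rw [hY.1.2.2 t]
          exact mem_biUnion (show s ∈ {q | SQ.lt q t} from hst) hs
        obtain ⟨y, hyU, hy, hyw⟩ := mem_closure_iff.1 this.1 U hU hwU
        exact ⟨y, hyU, consol_refines t hY hy, hyw⟩
      · obtain ⟨t, hst, rfl⟩ := aux_mor_lift hmor hlt
        obtain ⟨y, hyA, hy⟩ := (aux_trim_mem hA).2 (Or.inl hst)
        exact ⟨y, hAU hyA, consol_refines t hY hy, fun h => hwY ⟨t, h ▸ hy⟩⟩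

theorem consol_isTrim (hsurj : Function.Surjective α) (hmor : POSystem.IsMorphism SQ SP α)
    (hY : IsTrimPartition SQ Y) : IsTrimPartition SP (consol SQ Y α) := by
  refine ⟨consol_isPPartition hsurj hmor hY, fun w U hU => ?_, fun p _ w h => ?_, fun p w hw => ?_⟩
  · obtain ⟨A, ⟨q, hA⟩, hwA, hAU⟩ := hY.2.1 w U hU
    exact ⟨A, ⟨α q, consol_trim hmor hY hA⟩, hwA, hAU⟩
  · obtain ⟨B, hB, hwB, -⟩ := h univ univ_mem
    refine ⟨B, aux_trim_nhds hB hwB, fun A q hA hwA hAB => ?_⟩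
    have hA' := consol_trim (SP := SP) hmor hY hA
    obtain ⟨C, hC, hwC, hCA⟩ := h A (aux_trim_nhds hA hwA)
    exact aux_le_antisymm SP (aux_trim_le hC hA' hCA) (aux_trim_le hA' hB hAB)
  · obtain ⟨A, q, hA, hwA, -, rfl⟩ := consol_base hY hw univ_mem
    exact ⟨A, consol_trim hmor hY hA, hwA⟩

theorem consol_reg (hY : IsTrimPartition SQ Y) : RegRefines SQ SP Y (consol SQ Y α) α := by
  refine ⟨fun q => consol_refines q hY, fun p _ A hA => ?_⟩
  rw [← consol_ptype hY hA.2.1]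
  exact (aux_trim_mem hA).2 (Or.inr rfl)

end Aux

/-- existence and uniqueness of the regular consolidation `𝒴α`. -/
theorem exists_unique_regular_consolidation {P : Type u} {Q : Type v} {W : Type*}
    [Countable P] [Countable Q]
    [TopologicalSpace W] [SecondCountableTopology W] [LocallyCompactSpace W]
    [T2Space W] [TotallyDisconnectedSpace W]
    (SP : POSystem P) (SQ : POSystem Q) (α : Q → P)
    (hsurj : Function.Surjective α) (hmor : POSystem.IsMorphism SQ SP α)
    (Y : Q → Set W) (hY : IsTrimPartition SQ Y) :
    ∃! Z : P → Set W, IsTrimPartition SP Z ∧ RegRefines SQ SP Y Z α := by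
  refine ⟨consol SQ Y α, ⟨consol_isTrim hsurj hmor hY, consol_reg hY⟩, fun Z hZ => ?_⟩
  funext p
  exact Subset.antisymm
    (aux_unique hZ.1 hZ.2 (consol_isTrim hsurj hmor hY) (consol_reg hY) p)
    (aux_unique (consol_isTrim hsurj hmor hY) (consol_reg hY) hZ.1 hZ.2 p)
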